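/- The left ideals R·w and R·d of R coincide: Submodule.span R {w} = Submodule.span R {d}; moreover the family consisting of w together with the elements c^i * d for all integers i ≥ 0 is a K-basis of R·w, i.e. it is linearly independent over K and its K-linear span equals Submodule.span R {w} (viewed as a K-subspace of R). -/

import Mathlib

noncomputable section

/-- The defining relation `X * Y = 1` of the Jacobson algebra. -/
inductive JRel (K : Type*) [Field K] : FreeAlgebra K (Fin 2) → FreeAlgebra K (Fin 2) → Prop
  | rel : JRel K (FreeAlgebra.ι K 0 * FreeAlgebra.ι K 1) 1

/-- The Jacobson algebra `K⟨X, Y | XY = 1⟩`. -/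
abbrev Jacobson (K : Type*) [Field K] := RingQuot (JRel K)

variable (K : Type*) [Field K]

/-- The generator `X` of the Jacobson algebra. -/
def Xg : Jacobson K := RingQuot.mkAlgHom K (JRel K) (FreeAlgebra.ι K 0)

/-- The generator `Y` of the Jacobson algebra. -/
def Yg : Jacobson K := RingQuot.mkAlgHom K (JRel K) (FreeAlgebra.ι K 1)

/-- The loop `c = Y²X`. -/
def cJ : Jacobson K := Yg K ^ 2 * Xg K

/-- `F` is the set of irreducible polynomials `f ∈ K[x]` with `f(0) = -1`. -/
def FSet : Set (Polynomial K) := {f | Irreducible f ∧ f.eval 0 = -1}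

/-- The vertex idempotent `w = 1 - YX`. -/
def wJ : Jacobson K := 1 - Yg K * Xg K

/-- The exit edge `d = Y - Y²X`. -/
def dJ : Jacobson K := Yg K - Yg K ^ 2 * Xg K

/-- The family `w, d, cd, c²d, …`: `none ↦ w` and `some i ↦ c^i * d`. -/
def rwBasisFun : Option ℕ → Jacobson K
  | none => wJ K
  | some i => cJ K ^ i * dJ K

theorem aux_XY : Xg K * Yg K = 1 := by
  have h := RingQuot.mkAlgHom_rel K (JRel.rel (K := K))
  simpa [Xg, Yg] using h

theorem aux_Xw : Xg K * wJ K = 0 := by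
  rw [wJ, mul_sub, ← mul_assoc, aux_XY]; simp

theorem aux_d : dJ K = Yg K * wJ K := by
  simp [dJ, wJ, mul_sub, pow_two, mul_assoc]

theorem aux_cd (i : ℕ) : cJ K ^ i * dJ K = Yg K ^ (i + 1) * wJ K := by
  induction i with
  | zero => simp [aux_d]
  | succ n ih =>
    rw [pow_succ', mul_assoc, ih, cJ, pow_succ' (Yg K) n]
    calc Yg K ^ 2 * Xg K * (Yg K * Yg K ^ n * wJ K)
        = Yg K ^ 2 * (Xg K * Yg K) * Yg K ^ n * wJ K := by simp only [mul_assoc]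
      _ = _ := by rw [aux_XY, mul_one, ← pow_add]; congr 2; omega

/-- The exponent of `Y` attached to an index. -/
def auxIdx : Option ℕ → ℕ
  | none => 0
  | some i => i + 1

theorem auxIdx_inj : Function.Injective auxIdx := by
  intro a b h
  cases a <;> cases b <;> simp_all [auxIdx]

theorem aux_fun (o : Option ℕ) : rwBasisFun K o = Yg K ^ auxIdx o * wJ K := by
  cases o with
  | none => simp [rwBasisFun, auxIdx]
  | some i => exact aux_cd K i

theorem aux_range : Set.range (rwBasisFun K) = Set.range (fun n : ℕ => Yg K ^ n * wJ K) := by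
  ext x
  constructor
  · rintro ⟨o, rfl⟩
    exact ⟨auxIdx o, (aux_fun K o).symm⟩
  · rintro ⟨n, rfl⟩
    cases n with
    | zero => exact ⟨none, aux_fun K none⟩
    | succ n => exact ⟨some n, aux_fun K (some n)⟩

/-- The shift operators on `K[x]`: multiplication by `x` and division by `x`. -/
def auxGen : Fin 2 → Module.End K (Polynomial K) :=
  ![{ toFun := Polynomial.divX
      map_add' := fun _ _ => Polynomial.divX_add
      map_smul' := fun a p => by ext n; simp [Polynomial.coeff_divX] },
    LinearMap.mulLeft K Polynomial.X]

/-- The representation of the Jacobson algebra on `K[x]`. -/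
def auxRep : Jacobson K →ₐ[K] Module.End K (Polynomial K) :=
  RingQuot.liftAlgHom K ⟨FreeAlgebra.lift K (auxGen K), by
    intro a b h
    cases h
    rw [map_mul, map_one, FreeAlgebra.lift_ι_apply, FreeAlgebra.lift_ι_apply]
    refine LinearMap.ext fun p => ?_
    ext m
    simp [auxGen, Polynomial.coeff_divX]⟩

theorem auxRep_X (p : Polynomial K) : auxRep K (Xg K) p = p.divX := by
  simp [auxRep, Xg, auxGen]

theorem auxRep_Y (p : Polynomial K) : auxRep K (Yg K) p = Polynomial.X * p := by
  simp [auxRep, Yg, auxGen]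

theorem auxRep_Yw (n : ℕ) : auxRep K (Yg K ^ n * wJ K) 1 = Polynomial.X ^ n := by
  induction n with
  | zero => simp [wJ, auxRep_X, auxRep_Y]
  | succ n ih => rw [pow_succ', mul_assoc, map_mul, Module.End.mul_apply, ih, auxRep_Y, pow_succ']

theorem aux_indep : LinearIndependent K (fun n : ℕ => Yg K ^ n * wJ K) := by
  let f : Jacobson K →ₗ[K] Polynomial K :=
    (LinearMap.applyₗ (1 : Polynomial K)).comp (auxRep K).toLinearMap
  apply LinearIndependent.of_comp f
  have : f ∘ (fun n : ℕ => Yg K ^ n * wJ K) = fun n : ℕ => (Polynomial.X : Polynomial K) ^ n := by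
    funext n
    exact auxRep_Yw K n
  rw [this]
  have h := (Polynomial.basisMonomials K).linearIndependent
  simpa [Polynomial.coe_basisMonomials, Polynomial.X_pow_eq_monomial] using h

theorem aux_mul_mem (r s : Jacobson K)
    (hs : s ∈ Submodule.span K (Set.range (fun n : ℕ => Yg K ^ n * wJ K))) :
    r * s ∈ Submodule.span K (Set.range (fun n : ℕ => Yg K ^ n * wJ K)) := by
  obtain ⟨a, rfl⟩ := RingQuot.mkAlgHom_surjective K (JRel K) r
  induction a using FreeAlgebra.induction generalizing s with
  | grade0 k =>
    rw [AlgHom.commutes, ← Algebra.smul_def]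
    exact Submodule.smul_mem _ _ hs
  | grade1 x =>
    induction hs using Submodule.span_induction with
    | zero => simp
    | add u v _ _ hu hv => rw [mul_add]; exact add_mem hu hv
    | smul k u _ hu => rw [mul_smul_comm]; exact Submodule.smul_mem _ _ hu
    | mem u hu =>
      obtain ⟨n, rfl⟩ := hu
      fin_cases x
      · change Xg K * (Yg K ^ n * wJ K) ∈ _
        cases n with
        | zero => simp [aux_Xw]
        | succ n =>
          rw [pow_succ', mul_assoc, ← mul_assoc, aux_XY, one_mul]
          exact Submodule.subset_span ⟨n, rfl⟩
      · change Yg K * (Yg K ^ n * wJ K) ∈ _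
        rw [← mul_assoc, ← pow_succ']
        exact Submodule.subset_span ⟨n + 1, rfl⟩
  | mul a b ha hb => rw [map_mul, mul_assoc]; exact ha _ (hb _ hs)
  | add a b ha hb => rw [map_add, add_mul]; exact add_mem (ha _ hs) (hb _ hs)

/-- The left ideals `R·w` and `R·d` coincide, and the family consisting of `w` together
with the elements `c^i * d` (`i ≥ 0`) is a `K`-basis of `R·w`: it is `K`-linearly
independent and its `K`-linear span equals `R·w` viewed as a `K`-subspace. -/
theorem basis_of_Rw :
    Submodule.span (Jacobson K) {wJ K} = Submodule.span (Jacobson K) {dJ K} ∧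
      LinearIndependent K (rwBasisFun K) ∧
      Submodule.span K (Set.range (rwBasisFun K)) =
        (Submodule.span (Jacobson K) {wJ K}).restrictScalars K := by
  refine ⟨?_, ?_, ?_⟩
  · apply le_antisymm
    · rw [Submodule.span_singleton_le_iff_mem, Submodule.mem_span_singleton]
      refine ⟨Xg K, ?_⟩
      rw [smul_eq_mul, aux_d, ← mul_assoc, aux_XY, one_mul]
    · rw [Submodule.span_singleton_le_iff_mem, Submodule.mem_span_singleton]
      exact ⟨Yg K, (aux_d K).symm⟩
  · have h := (aux_indep K).comp auxIdx auxIdx_inj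
    have e : rwBasisFun K = (fun n : ℕ => Yg K ^ n * wJ K) ∘ auxIdx := funext (aux_fun K)
    rw [e]
    exact h
  · rw [aux_range]
    apply le_antisymm
    · rw [Submodule.span_le]
      rintro _ ⟨n, rfl⟩
      exact Submodule.mem_span_singleton.2 ⟨Yg K ^ n, rfl⟩
    · intro x hx
      obtain ⟨r, rfl⟩ := Submodule.mem_span_singleton.1 hx
      exact aux_mul_mem K r _ (Submodule.subset_span ⟨0, by simp⟩)
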